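/- Fix n ∈ ℕ₀, λ ∈ ℝ, e ∈ (-1,1), and set E := e + i·√(1-e²). Let Σ be the 4×4 complex block matrix Σ = [[A, B],[σ₁Bσ₁, A]] with A := (1-E²)^{-1}·[[1-λE², (1-λ)E],[(1-λ)E, 1-λE²]], B := (1-λ)·E^{2n+1}·(1-E²)^{-1}·[[1, E],[E, E²]], σ₁ = [[0,1],[1,0]], and let Δ_λ(e) := (1-E²)^{-2}·[(1-λ²E²)² - (1-λ²)²·E^{4n+4}]. If Δ_λ(e) ≠ 0, then Σ is invertible and Σ^{-1} = Δ_λ(e)^{-1}·[[M, N],[σ₁Nσ₁, σ₁Mσ₁]], where M = [[a, b],[c, a]], N = [[d, g],[g, f]] with a = [1-E^{4n+4} - E²(1-E^{4n+2})(λ+λ²) + E⁴(1-E^{4n})λ³]/(1-E²)², b = [-E(1-E^{4n+2})(1-λ) + E³(1-E^{4n})(λ²-λ³)]/(1-E²)², c = [-E(1-E^{4n+4})(1-λ) + E³(1-E^{4n+2})(λ²-λ³)]/(1-E²)², d = -E^{2n+1}(1-λ)/(1-E²), g = -E^{2n+2}(λ-λ²)/(1-E²), f = -E^{2n+3}(λ²-λ³)/(1-E²).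 -/

import Mathlib

open Complex Matrix

/-- The unit complex number `e + i√(1 - e²)` with `e ∈ (-1, 1)` does not square to one. -/
lemma one_sub_sq_add_I_mul_sqrt_ne_zero {e : ℝ} (he : e ∈ Set.Ioo (-1 : ℝ) 1) :
    1 - ((e : ℂ) + Complex.I * (Real.sqrt (1 - e ^ 2) : ℂ)) ^ 2 ≠ 0 := by
  obtain ⟨h1, h2⟩ := he
  have hpos : 0 < 1 - e ^ 2 := by nlinarith
  have hs := Real.sq_sqrt hpos.le
  intro h
  have hre := congrArg Complex.re h
  simp [pow_two] at hre
  nlinarith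

/-- The product of the block matrix with the claimed multiple of its inverse, for any `x` with `x ^ 2 ≠ 1`. -/
lemma fromBlocks_mul_fromBlocks_eq_smul_one (n : ℕ) (l x : ℂ) (hx : 1 - x ^ 2 ≠ 0) :
    let A : Matrix (Fin 2) (Fin 2) ℂ :=
      (1 - x ^ 2)⁻¹ • !![1 - l * x ^ 2, (1 - l) * x; (1 - l) * x, 1 - l * x ^ 2]
    let B : Matrix (Fin 2) (Fin 2) ℂ :=
      ((1 - l) * x ^ (2 * n + 1) * (1 - x ^ 2)⁻¹) • !![1, x; x, x ^ 2]
    let s1 : Matrix (Fin 2) (Fin 2) ℂ := !![0, 1; 1, 0]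
    let a : ℂ := (1 - x ^ (4 * n + 4) - x ^ 2 * (1 - x ^ (4 * n + 2)) * (l + l ^ 2)
      + x ^ 4 * (1 - x ^ (4 * n)) * l ^ 3) / (1 - x ^ 2) ^ 2
    let b : ℂ := (-(x * (1 - x ^ (4 * n + 2)) * (1 - l))
      + x ^ 3 * (1 - x ^ (4 * n)) * (l ^ 2 - l ^ 3)) / (1 - x ^ 2) ^ 2
    let c : ℂ := (-(x * (1 - x ^ (4 * n + 4)) * (1 - l))
      + x ^ 3 * (1 - x ^ (4 * n + 2)) * (l ^ 2 - l ^ 3)) / (1 - x ^ 2) ^ 2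
    let d : ℂ := -(x ^ (2 * n + 1) * (1 - l)) / (1 - x ^ 2)
    let g : ℂ := -(x ^ (2 * n + 2) * (l - l ^ 2)) / (1 - x ^ 2)
    let f : ℂ := -(x ^ (2 * n + 3) * (l ^ 2 - l ^ 3)) / (1 - x ^ 2)
    let M : Matrix (Fin 2) (Fin 2) ℂ := !![a, b; c, a]
    let N : Matrix (Fin 2) (Fin 2) ℂ := !![d, g; g, f]
    Matrix.fromBlocks A B (s1 * B * s1) A *
        Matrix.fromBlocks M N (s1 * N * s1) (s1 * M * s1) =
      (((1 - x ^ 2) ^ 2)⁻¹ *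
        ((1 - l ^ 2 * x ^ 2) ^ 2 - (1 - l ^ 2) ^ 2 * x ^ (4 * n + 4))) • 1 := by
  intro A B s1 a b c d g f M N
  rw [Matrix.fromBlocks_multiply, ← Matrix.fromBlocks_one, Matrix.fromBlocks_smul]
  have h4 : x ^ (4 * n) = (x ^ (2 * n)) ^ 2 := by rw [← pow_mul]; ring_nf
  simp only [A, B, s1, a, b, c, d, g, f, M, N, pow_add, h4]
  generalize x ^ (2 * n) = y
  congr 1 <;> ext i j <;> fin_cases i <;> fin_cases j <;>
    simp <;> field_simp <;> ring

/-- Inverse of the boundary interaction matrix: if `Δ_λ(e) ≠ 0` then `Σ` is invertible with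
`Σ⁻¹ = Δ_λ(e)⁻¹ [[M, N],[σ₁Nσ₁, σ₁Mσ₁]]` for the explicitly given 2×2 blocks `M`, `N`. -/
theorem stmt_10 (n : ℕ) (l : ℝ) (e : ℝ) (he : e ∈ Set.Ioo (-1 : ℝ) 1) :
    let E : ℂ := (e : ℂ) + Complex.I * (Real.sqrt (1 - e ^ 2) : ℂ)
    let lc : ℂ := (l : ℂ)
    let A : Matrix (Fin 2) (Fin 2) ℂ :=
      (1 - E ^ 2)⁻¹ • !![1 - lc * E ^ 2, (1 - lc) * E;
                         (1 - lc) * E, 1 - lc * E ^ 2]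
    let B : Matrix (Fin 2) (Fin 2) ℂ :=
      ((1 - lc) * E ^ (2 * n + 1) * (1 - E ^ 2)⁻¹) • !![1, E; E, E ^ 2]
    let s1 : Matrix (Fin 2) (Fin 2) ℂ := !![0, 1; 1, 0]
    let S : Matrix (Fin 2 ⊕ Fin 2) (Fin 2 ⊕ Fin 2) ℂ := Matrix.fromBlocks A B (s1 * B * s1) A
    let Δ : ℂ := ((1 - E ^ 2) ^ 2)⁻¹ *
      ((1 - lc ^ 2 * E ^ 2) ^ 2 - (1 - lc ^ 2) ^ 2 * E ^ (4 * n + 4))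
    let a : ℂ := (1 - E ^ (4 * n + 4) - E ^ 2 * (1 - E ^ (4 * n + 2)) * (lc + lc ^ 2)
      + E ^ 4 * (1 - E ^ (4 * n)) * lc ^ 3) / (1 - E ^ 2) ^ 2
    let b : ℂ := (-(E * (1 - E ^ (4 * n + 2)) * (1 - lc))
      + E ^ 3 * (1 - E ^ (4 * n)) * (lc ^ 2 - lc ^ 3)) / (1 - E ^ 2) ^ 2
    let c : ℂ := (-(E * (1 - E ^ (4 * n + 4)) * (1 - lc))
      + E ^ 3 * (1 - E ^ (4 * n + 2)) * (lc ^ 2 - lc ^ 3)) / (1 - E ^ 2) ^ 2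
    let d : ℂ := -(E ^ (2 * n + 1) * (1 - lc)) / (1 - E ^ 2)
    let g : ℂ := -(E ^ (2 * n + 2) * (lc - lc ^ 2)) / (1 - E ^ 2)
    let f : ℂ := -(E ^ (2 * n + 3) * (lc ^ 2 - lc ^ 3)) / (1 - E ^ 2)
    let M : Matrix (Fin 2) (Fin 2) ℂ := !![a, b; c, a]
    let N : Matrix (Fin 2) (Fin 2) ℂ := !![d, g; g, f]
    Δ ≠ 0 →
      IsUnit S ∧
      S⁻¹ = Δ⁻¹ • Matrix.fromBlocks M N (s1 * N * s1) (s1 * M * s1) := by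
  intro E lc A B s1 S Δ a b c d g f M N hΔ
  have hST : S * (Δ⁻¹ • Matrix.fromBlocks M N (s1 * N * s1) (s1 * M * s1)) = 1 := by
    have h := fromBlocks_mul_fromBlocks_eq_smul_one n lc E
      (one_sub_sq_add_I_mul_sqrt_ne_zero he)
    rw [Matrix.mul_smul]
    exact (congrArg (Δ⁻¹ • ·) h).trans (inv_smul_smul₀ hΔ 1)
  exact ⟨IsUnit.of_mul_eq_one _ hST, Matrix.inv_eq_right_inv hST⟩
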